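/- Let (E,j) be a soft inductive system of Banach spaces over a directed set N. For each n ∈ N let T_n : [0,∞) → L(E_n) satisfy T_n(0) = id, T_n(t+s) = T_n(t)T_n(s) and ‖T_n(t)‖ ≤ 1 for all s,t ≥ 0, and assume that for each t ≥ 0 the net T_•(t) maps j-convergent nets to j-convergent nets. Then the induced limit operators T_∞(t) on E_∞ (defined by T_∞(t)(j-lim_n x_n) = j-lim_n T_n(t) x_n) are linear contractions forming a one-parameter semigroup: T_∞(0) = id and T_∞(t+s) = T_∞(t) T_∞(s) for all s,t ≥ 0. -/

import Mathlib

open Filter Topology MeasureTheory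

variable {N : Type*} [Preorder N] [IsDirected N (· ≤ ·)] [Nonempty N]
variable {E : N → Type*} [∀ n, NormedAddCommGroup (E n)] [∀ n, NormedSpace ℂ (E n)]
  [∀ n, CompleteSpace (E n)]

/-- A *soft inductive system* of Banach spaces over the directed set `N`:
linear contractions `j n m : E m → E n` (for `n ≥ m`, with `j n n = id` and
`j n m = 0` when `¬ m ≤ n`), satisfying
`lim_m limsup_n ‖(j n l - j n m ∘ j m l) x‖ = 0` for all `l` and `x : E l`. -/
structure IsSoftInductiveSystem (j : ∀ n m : N, E m →L[ℂ] E n) : Prop where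
  map_self : ∀ n, j n n = ContinuousLinearMap.id ℂ (E n)
  map_not_le : ∀ n m, ¬ m ≤ n → j n m = 0
  contraction : ∀ n m, m ≤ n → ∀ x : E m, ‖j n m x‖ ≤ ‖x‖
  soft : ∀ (l : N) (x : E l),
    Tendsto (fun m => limsup (fun n => ‖j n l x - j n m (j m l x)‖) atTop)
      atTop (𝓝 0)

/-- A net `x = (x n)_{n ∈ N}` (with `x n ∈ E n`) is uniformly bounded. -/
def UniformlyBounded (x : ∀ n, E n) : Prop := ∃ C : ℝ, ∀ n, ‖x n‖ ≤ C

/-- The seminorm `|‖x‖| = limsup_n ‖x n‖` on uniformly bounded nets. -/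
noncomputable def netSeminorm (x : ∀ n, E n) : ℝ := limsup (fun n => ‖x n‖) atTop

/-- The basic net `j_{• m} ξ` associated with `ξ ∈ E m`. -/
def basicNet (j : ∀ n m : N, E m →L[ℂ] E n) (m : N) (ξ : E m) : ∀ n, E n :=
  fun n => j n m ξ

/-- A uniformly bounded net is `j`-convergent if it lies in the seminorm-closure of
the set of basic nets. -/
def JConvergent (j : ∀ n m : N, E m →L[ℂ] E n) (x : ∀ n, E n) : Prop :=
  UniformlyBounded x ∧
    ∀ ε : ℝ, 0 < ε → ∃ (m : N) (ξ : E m), netSeminorm (fun n => x n - j n m ξ) < ε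

/-- A net is a null net if `lim_n ‖x n‖ = 0`. -/
def IsNullNet (x : ∀ n, E n) : Prop := Tendsto (fun n => ‖x n‖) atTop (𝓝 0)

/-- A realization `(G, L)` of the limit space `E_∞ = C(E,j)/C₀(E,j)` of a soft inductive
system: `L` sends a `j`-convergent net to its `j`-limit; it is linear on `j`-convergent
nets, the norm of a `j`-limit is the seminorm of the net, and every element of `G`
arises as a `j`-limit. -/
structure IsLimitSpace (j : ∀ n m : N, E m →L[ℂ] E n) (G : Type*)
    [NormedAddCommGroup G] [NormedSpace ℂ G] (L : (∀ n, E n) → G) : Prop where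
  map_add : ∀ x y, JConvergent j x → JConvergent j y → L (x + y) = L x + L y
  map_smul : ∀ (c : ℂ) (x), JConvergent j x → L (c • x) = c • L x
  norm_eq : ∀ x, JConvergent j x → ‖L x‖ = netSeminorm x
  surjective : ∀ g : G, ∃ x, JConvergent j x ∧ L x = g

lemma UniformlyBounded.isBoundedUnder {x : ∀ n, E n} (hx : UniformlyBounded x) :
    IsBoundedUnder (· ≤ ·) atTop fun n => ‖x n‖ :=
  let ⟨C, hC⟩ := hx
  isBoundedUnder_of ⟨C, hC⟩

lemma UniformlyBounded.eventually_lt {x : ∀ n, E n} (hx : UniformlyBounded x) {ε : ℝ}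
    (h : netSeminorm x < ε) : ∀ᶠ n in atTop, ‖x n‖ < ε :=
  eventually_lt_of_limsup_lt h hx.isBoundedUnder

lemma isCoboundedUnder_norm (x : ∀ n, E n) :
    IsCoboundedUnder (· ≤ ·) atTop fun n => ‖x n‖ :=
  (isBoundedUnder_of ⟨0, fun n => norm_nonneg (x n)⟩ :
    IsBoundedUnder (· ≥ ·) atTop fun n => ‖x n‖).isCoboundedUnder_le

lemma netSeminorm_le {x : ∀ n, E n} {ε : ℝ} (h : ∀ᶠ n in atTop, ‖x n‖ ≤ ε) :
    netSeminorm x ≤ ε :=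
  limsup_le_of_le (isCoboundedUnder_norm x) h

lemma netSeminorm_mono {x y : ∀ n, E n} (hy : UniformlyBounded y)
    (h : ∀ n, ‖x n‖ ≤ ‖y n‖) : netSeminorm x ≤ netSeminorm y :=
  limsup_le_limsup (Eventually.of_forall h) (isCoboundedUnder_norm x) hy.isBoundedUnder

lemma UniformlyBounded.add {x y : ∀ n, E n} (hx : UniformlyBounded x)
    (hy : UniformlyBounded y) : UniformlyBounded (x + y) :=
  let ⟨C, hC⟩ := hx
  let ⟨D, hD⟩ := hy
  ⟨C + D, fun n => norm_add_le_of_le (hC n) (hD n)⟩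

lemma UniformlyBounded.sub {x y : ∀ n, E n} (hx : UniformlyBounded x)
    (hy : UniformlyBounded y) : UniformlyBounded (x - y) :=
  let ⟨C, hC⟩ := hx
  let ⟨D, hD⟩ := hy
  ⟨C + D, fun n => norm_sub_le_of_le (hC n) (hD n)⟩

lemma UniformlyBounded.smul {x : ∀ n, E n} (c : ℂ) (hx : UniformlyBounded x) :
    UniformlyBounded (c • x) :=
  let ⟨C, hC⟩ := hx
  ⟨‖c‖ * C, fun n => by
    rw [Pi.smul_apply, norm_smul]
    exact mul_le_mul_of_nonneg_left (hC n) (norm_nonneg c)⟩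

namespace IsSoftInductiveSystem

variable {j : ∀ n m : N, E m →L[ℂ] E n}

lemma uniformlyBounded_basicNet (hj : IsSoftInductiveSystem j) (m : N) (ξ : E m) :
    UniformlyBounded (basicNet j m ξ) := by
  refine ⟨‖ξ‖, fun n => ?_⟩
  by_cases h : m ≤ n
  · exact hj.contraction n m h ξ
  · simp [basicNet, hj.map_not_le n m h]

/-- A `j`-convergent net is eventually approximated by basic nets based at any large index. -/
lemma eventually_approx (hj : IsSoftInductiveSystem j) {x : ∀ n, E n} (hx : JConvergent j x)
    {ε : ℝ} (hε : 0 < ε) :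
    ∀ᶠ p in atTop, ∃ ξ : E p, ∀ᶠ n in atTop, ‖x n - j n p ξ‖ < ε := by
  obtain ⟨m, ξ, hξ⟩ := hx.2 (ε / 2) (half_pos hε)
  filter_upwards [(hj.soft m ξ).eventually_lt_const (half_pos hε)] with p hp
  refine ⟨j p m ξ, ?_⟩
  filter_upwards [(hx.1.sub (hj.uniformlyBounded_basicNet m ξ)).eventually_lt hξ,
    ((hj.uniformlyBounded_basicNet m ξ).sub
      (hj.uniformlyBounded_basicNet p (j p m ξ))).eventually_lt hp] with n h₁ h₂
  calc ‖x n - j n p (j p m ξ)‖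
      ≤ ‖x n - j n m ξ‖ + ‖j n m ξ - j n p (j p m ξ)‖ := norm_sub_le_norm_sub_add_norm_sub _ _ _
    _ < ε / 2 + ε / 2 := add_lt_add h₁ h₂
    _ = ε := add_halves ε

lemma jConvergent_add (hj : IsSoftInductiveSystem j) {x y : ∀ n, E n}
    (hx : JConvergent j x) (hy : JConvergent j y) : JConvergent j (x + y) := by
  refine ⟨hx.1.add hy.1, fun ε hε => ?_⟩
  have hε' : 0 < ε / 4 := by positivity
  obtain ⟨p, ⟨ξ, hξ⟩, η, hη⟩ :=
    ((hj.eventually_approx hx hε').and (hj.eventually_approx hy hε')).exists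
  refine ⟨p, ξ + η, (netSeminorm_le (ε := ε / 2) ?_).trans_lt (half_lt_self hε)⟩
  filter_upwards [hξ, hη] with n h₁ h₂
  rw [Pi.add_apply, map_add, add_sub_add_comm]
  linarith [norm_add_le (x n - j n p ξ) (y n - j n p η)]

lemma jConvergent_smul (hj : IsSoftInductiveSystem j) {x : ∀ n, E n} (c : ℂ)
    (hx : JConvergent j x) : JConvergent j (c • x) := by
  refine ⟨hx.1.smul c, fun ε hε => ?_⟩
  have hc : 0 < ‖c‖ + 1 := by positivity
  obtain ⟨m, ξ, hξ⟩ := hx.2 (ε / 2 / (‖c‖ + 1)) (by positivity)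
  refine ⟨m, c • ξ, (netSeminorm_le (ε := ε / 2) ?_).trans_lt (half_lt_self hε)⟩
  filter_upwards [(hx.1.sub (hj.uniformlyBounded_basicNet m ξ)).eventually_lt hξ] with n hn
  rw [Pi.smul_apply, map_smul, ← smul_sub, norm_smul]
  rw [lt_div_iff₀ hc] at hn
  change ‖x n - j n m ξ‖ * (‖c‖ + 1) < ε / 2 at hn
  nlinarith [norm_nonneg (x n - j n m ξ)]

end IsSoftInductiveSystem

/-- A net of contractions preserving `j`-convergence induces a contraction on the limit space. -/
lemma IsLimitSpace.exists_limit_operator {j : ∀ n m : N, E m →L[ℂ] E n}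
    (hj : IsSoftInductiveSystem j) {G : Type*} [NormedAddCommGroup G] [NormedSpace ℂ G]
    {L : (∀ n, E n) → G} (hL : IsLimitSpace j G L) (A : ∀ n, E n →L[ℂ] E n)
    (hA : ∀ n, ∀ ξ : E n, ‖A n ξ‖ ≤ ‖ξ‖)
    (hconv : ∀ x : ∀ n, E n, JConvergent j x → JConvergent j fun n => A n (x n)) :
    ∃ S : G →L[ℂ] G, (∀ x, JConvergent j x → S (L x) = L fun n => A n (x n)) ∧
      ∀ g, ‖S g‖ ≤ ‖g‖ := by
  have bound (x) (hx : JConvergent j x) : ‖L fun n => A n (x n)‖ ≤ ‖L x‖ := by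
    rw [hL.norm_eq x hx, hL.norm_eq _ (hconv x hx)]
    exact netSeminorm_mono hx.1 fun n => hA n (x n)
  have add (x y) (hx : JConvergent j x) (hy : JConvergent j y) :
      (L fun n => A n ((x + y) n)) = (L fun n => A n (x n)) + L fun n => A n (y n) := by
    rw [← hL.map_add _ _ (hconv x hx) (hconv y hy)]
    congr 1
    ext n
    simp
  have smul (c : ℂ) (x) (hx : JConvergent j x) :
      (L fun n => A n ((c • x) n)) = c • L fun n => A n (x n) := by
    rw [← hL.map_smul c _ (hconv x hx)]
    congr 1
    ext n
    simp
  have wd (x y) (hx : JConvergent j x) (hy : JConvergent j y) (h : L x = L y) :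
      (L fun n => A n (x n)) = L fun n => A n (y n) := by
    have hy' := hj.jConvergent_smul (-1) hy
    have key := bound _ (hj.jConvergent_add hx hy')
    rw [add _ _ hx hy', smul _ _ hy, hL.map_add _ _ hx hy', hL.map_smul _ _ hy, h] at key
    simpa [← sub_eq_add_neg, sub_eq_zero] using key
  choose r hr hLr using hL.surjective
  let S : G →ₗ[ℂ] G :=
    { toFun := fun g => L fun n => A n (r g n)
      map_add' := fun g h => by
        rw [← add _ _ (hr g) (hr h)]
        refine wd _ _ (hr _) (hj.jConvergent_add (hr g) (hr h)) ?_
        rw [hL.map_add _ _ (hr g) (hr h), hLr, hLr, hLr]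
      map_smul' := fun c g => by
        rw [RingHom.id_apply, ← smul c _ (hr g)]
        refine wd _ _ (hr _) (hj.jConvergent_smul c (hr g)) ?_
        rw [hL.map_smul _ _ (hr g), hLr, hLr] }
  have hS (g) : ‖S g‖ ≤ ‖g‖ := (bound _ (hr g)).trans_eq (by rw [hLr])
  exact ⟨S.mkContinuous 1 fun g => by simpa using hS g,
    fun x hx => wd _ _ (hr _) hx (hLr _), hS⟩

/-- If each `T n` is a one-parameter contraction semigroup on
`E n` and for each `t ≥ 0` the net `T • t` preserves `j`-convergence, then the limit
operators form a one-parameter semigroup of linear contractions on the limit space: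
`T_∞ 0 = id`, `T_∞ (t + s) = T_∞ t ∘ T_∞ s`. -/
theorem limit_semigroup (j : ∀ n m : N, E m →L[ℂ] E n)
    (hj : IsSoftInductiveSystem j)
    (T : ∀ n, ℝ → (E n →L[ℂ] E n))
    (hT0 : ∀ n, T n 0 = ContinuousLinearMap.id ℂ (E n))
    (hTsg : ∀ n, ∀ s t : ℝ, 0 ≤ s → 0 ≤ t → T n (t + s) = (T n t).comp (T n s))
    (hTcontr : ∀ n, ∀ t : ℝ, 0 ≤ t → ∀ ξ : E n, ‖T n t ξ‖ ≤ ‖ξ‖)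
    (hTconv : ∀ t : ℝ, 0 ≤ t → ∀ x : ∀ n, E n, JConvergent j x →
      JConvergent j (fun n => T n t (x n)))
    {G : Type*} [NormedAddCommGroup G] [NormedSpace ℂ G] [CompleteSpace G]
    (L : (∀ n, E n) → G) (hL : IsLimitSpace j G L) :
    ∃ Tinf : ℝ → (G →L[ℂ] G),
      (∀ t : ℝ, 0 ≤ t → ∀ x : ∀ n, E n, JConvergent j x →
        Tinf t (L x) = L (fun n => T n t (x n))) ∧
      (∀ t : ℝ, 0 ≤ t → ∀ g : G, ‖Tinf t g‖ ≤ ‖g‖) ∧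
      Tinf 0 = ContinuousLinearMap.id ℂ G ∧
      (∀ s t : ℝ, 0 ≤ s → 0 ≤ t → Tinf (t + s) = (Tinf t).comp (Tinf s)) := by
  have hex (t : ℝ) : ∃ S : G →L[ℂ] G, 0 ≤ t →
      (∀ x, JConvergent j x → S (L x) = L fun n => T n t (x n)) ∧ ∀ g, ‖S g‖ ≤ ‖g‖ := by
    by_cases ht : 0 ≤ t
    · obtain ⟨S, hS⟩ := hL.exists_limit_operator hj (T · t) (hTcontr · t ht) (hTconv t ht)
      exact ⟨S, fun _ => hS⟩
    · exact ⟨0, fun h => absurd h ht⟩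
  choose S hS using hex
  refine ⟨S, fun t ht => (hS t ht).1, fun t ht => (hS t ht).2, ?_, fun s t hs ht => ?_⟩
  · ext g
    obtain ⟨x, hx, rfl⟩ := hL.surjective g
    simp [(hS 0 le_rfl).1 x hx, hT0]
  · ext g
    obtain ⟨x, hx, rfl⟩ := hL.surjective g
    rw [ContinuousLinearMap.comp_apply, (hS _ (add_nonneg ht hs)).1 x hx, (hS s hs).1 x hx,
      (hS t ht).1 _ (hTconv s hs x hx)]
    simp [hTsg _ s t hs ht]
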